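/- Let (u,R) and (v,S) be admissible pairs, and suppose that σ_{u(R)} = σ_{v(S)}. Then u(R) = v(S). -/

import Mathlib

open scoped RealInnerProductSpace
open Classical

noncomputable section

variable (V : Type) [NormedAddCommGroup V] [InnerProductSpace ℝ V]

/-- The reflection determined by a vector `α` (the identity map if `α = 0`),
as a linear endomorphism:  `x ↦ x - (2⟪x,α⟫/⟪α,α⟫) • α`. -/
def reflMap (α : V) : V →ₗ[ℝ] V where
  toFun x := x - (2 * ⟪x, α⟫ / ⟪α, α⟫) • α
  map_add' x y := by
    simp only [inner_add_left]
    rw [show 2 * (⟪x, α⟫ + ⟪y, α⟫) / ⟪α, α⟫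
        = 2 * ⟪x, α⟫ / ⟪α, α⟫ + 2 * ⟪y, α⟫ / ⟪α, α⟫ by ring, add_smul]
    abel
  map_smul' c x := by
    simp only [real_inner_smul_left, RingHom.id_apply, smul_sub]
    rw [show 2 * (c * ⟪x, α⟫) / ⟪α, α⟫ = c * (2 * ⟪x, α⟫ / ⟪α, α⟫) by ring,
      mul_smul]

lemma reflMap_apply (α x : V) :
    reflMap V α x = x - (2 * ⟪x, α⟫ / ⟪α, α⟫) • α := rfl

lemma reflMap_involutive (α : V) : ∀ x, reflMap V α (reflMap V α x) = x := by
  intro x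
  by_cases h : (⟪α, α⟫ : ℝ) = 0
  · have h0 : α = 0 := inner_self_eq_zero.mp h
    simp [reflMap_apply, h0]
  · rw [reflMap_apply, reflMap_apply, inner_sub_left, real_inner_smul_left,
      div_mul_cancel₀ _ h]
    rw [show ⟪x, α⟫ - 2 * ⟪x, α⟫ = -⟪x, α⟫ by ring]
    rw [show 2 * -⟪x, α⟫ / ⟪α, α⟫ = -(2 * ⟪x, α⟫ / ⟪α, α⟫) by ring, neg_smul]
    abel

/-- The reflection determined by a vector `α`, as a linear automorphism of `V`. -/
def sref (α : V) : V ≃ₗ[ℝ] V :=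
  { reflMap V α with
    invFun := reflMap V α
    left_inv := reflMap_involutive V α
    right_inv := reflMap_involutive V α }

lemma sref_apply (α x : V) :
    sref V α x = x - (2 * ⟪x, α⟫ / ⟪α, α⟫) • α := rfl

variable {V}

/-- The coroot `α^∨ = 2α/⟪α,α⟫` associated with a root `α`, under the identification of the
coweight space with `V` given by the inner product. -/
def coroot (α : V) : V := (2 / ⟪α, α⟫) • α

/-- The dimension of the `(-1)`-eigenspace of a linear automorphism. -/
def lamEig (σ : V ≃ₗ[ℝ] V) : ℕ :=
  Module.finrank ℝ (Module.End.eigenspace (σ : V →ₗ[ℝ] V) (-1))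

/-- The action `s_α ∘ σ` of a simple reflection on an involution: `s_α σ` if `s_α` and `σ`
commute, and `s_α σ s_α` otherwise. -/
def circAct (α : V) (σ : V ≃ₗ[ℝ] V) : V ≃ₗ[ℝ] V :=
  if sref V α * σ = σ * sref V α then sref V α * σ else sref V α * σ * sref V α

/-- A set of pairwise orthogonal vectors. -/
def OrthSet (S : Finset V) : Prop :=
  (↑S : Set V).Pairwise fun a b => ⟪a, b⟫ = 0

/-- The product `σ_S` of the (commuting) reflections in the elements of an orthogonal set
`S`. -/
def sigmaOf (S : Finset V) : V ≃ₗ[ℝ] V :=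
  (S.toList.map (sref V)).prod

variable (V)

/-- A finite crystallographic reduced root system in the Euclidean space `V`,
together with a fixed choice of simple roots. -/
structure RSD where
  /-- The set of roots. -/
  Φ : Finset V
  /-- The set of simple roots. -/
  Δ : Finset V
  nonzero : (0 : V) ∉ Φ
  span_top : Submodule.span ℝ (Φ : Set V) = ⊤
  reduced : ∀ α ∈ Φ, ∀ c : ℝ, c • α ∈ Φ → c = 1 ∨ c = -1
  crystal : ∀ α ∈ Φ, ∀ β ∈ Φ, ∃ n : ℤ, (n : ℝ) = 2 * ⟪β, α⟫ / ⟪α, α⟫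
  reflClosed : ∀ α ∈ Φ, ∀ β ∈ Φ, sref V α β ∈ Φ
  Δ_sub : Δ ⊆ Φ
  Δ_indep : LinearIndependent ℝ (fun x : (Δ : Set V) => (x : V))
  Δ_base : ∀ α ∈ Φ, (∃ c : V → ℕ, α = ∑ γ ∈ Δ, (c γ : ℝ) • γ) ∨
      (∃ c : V → ℕ, -α = ∑ γ ∈ Δ, (c γ : ℝ) • γ)

namespace RSD

variable {V}
variable (D : RSD V)

/-- The set of positive roots. -/
def Pos : Set V :=
  {α | α ∈ D.Φ ∧ ∃ c : V → ℕ, α = ∑ γ ∈ D.Δ, (c γ : ℝ) • γ}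

/-- The set of negative roots. -/
def Neg : Set V := {α | -α ∈ D.Pos}

/-- The Weyl group, as the subgroup of `GL(V)` generated by the simple reflections. -/
def W : Subgroup (V ≃ₗ[ℝ] V) := Subgroup.closure ((fun γ => sref V γ) '' ↑D.Δ)

/-- The length of `w`: the least number of simple reflections needed to write `w` as a
product of simple reflections. -/
def length (w : V ≃ₗ[ℝ] V) : ℕ :=
  sInf {n | ∃ l : List V, l.length = n ∧ (∀ γ ∈ l, γ ∈ D.Δ) ∧ w = (l.map (sref V)).prod}

/-- The Bruhat order on the Weyl group: `u ≤ v` iff `v` is obtained from `u` by successively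
multiplying by reflections, each time increasing the length. -/
def ble (u v : V ≃ₗ[ℝ] V) : Prop :=
  Relation.ReflTransGen
    (fun x y => (∃ β ∈ D.Φ, y = sref V β * x) ∧ D.length x < D.length y) u v

/-- The strict Bruhat order. -/
def blt (u v : V ≃ₗ[ℝ] V) : Prop := D.ble u v ∧ u ≠ v

/-- The dominance order: `y - x` is a nonnegative integer combination of simple roots. -/
def dom (x y : V) : Prop := ∃ c : V → ℕ, y - x = ∑ γ ∈ D.Δ, (c γ : ℝ) • γ

/-- The dominance order on coweights: `y - x` is a nonnegative integer combination of simple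
coroots. -/
def cdom (x y : V) : Prop := ∃ c : V → ℕ, y - x = ∑ γ ∈ D.Δ, (c γ : ℝ) • coroot γ

/-- The length `L(σ) = (ℓ(σ) + λ(σ))/2` of an involution `σ`, where `λ(σ)` is the dimension
of the `(-1)`-eigenspace of `σ`. -/
def Linv (σ : V ≃ₗ[ℝ] V) : ℚ :=
  ((D.length σ : ℚ) + (lamEig σ : ℚ)) / 2

end RSD

/-- A finite irreducible crystallographic reduced root system, with a fixed choice of simple
roots and a marked simple root `αP` whose coefficient in the highest root `θ` equals `1`
(the cominuscule case). -/
structure MRSD extends RSD V where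
  irred : ¬ ∃ A B : Set V, A.Nonempty ∧ B.Nonempty ∧ A ∪ B = ↑Φ ∧
      ∀ α ∈ A, ∀ β ∈ B, ⟪α, β⟫ = 0
  /-- The marked simple root. -/
  αP : V
  αP_mem : αP ∈ Δ
  /-- The highest root. -/
  θ : V
  θ_mem : θ ∈ Φ
  θ_high : ∀ α ∈ Φ, ∃ c : V → ℕ, θ - α = ∑ γ ∈ Δ, (c γ : ℝ) • γ
  θ_coeff : ∃ c : V → ℕ, (θ = ∑ γ ∈ Δ, (c γ : ℝ) • γ) ∧ c αP = 1

namespace MRSD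

variable {V}
variable (M : MRSD V)

/-- The set `Ψ` of positive roots in which the marked simple root `αP` has coefficient `1`. -/
def Psi : Set V :=
  {α | α ∈ M.Φ ∧ ∃ c : V → ℕ, (α = ∑ γ ∈ M.Δ, (c γ : ℝ) • γ) ∧ c M.αP = 1}

/-- The set of positive roots of the subsystem `Φ_P`, i.e. the positive roots in which the
marked simple root `αP` has coefficient `0`. -/
def PosP : Set V :=
  {α | α ∈ M.Φ ∧ ∃ c : V → ℕ, (α = ∑ γ ∈ M.Δ, (c γ : ℝ) • γ) ∧ c M.αP = 0}

/-- The parabolic subgroup `W_P` generated by the simple reflections in `Δ ∖ {αP}`. -/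
def WP : Subgroup (V ≃ₗ[ℝ] V) :=
  Subgroup.closure ((fun γ => sref V γ) '' ↑(M.Δ.erase M.αP))

/-- The inversion set `Φ⁺(v) = {α ∈ Φ⁺ : v(α) ∈ Φ⁻}`. -/
def InvSet (v : V ≃ₗ[ℝ] V) : Set V := {α | α ∈ M.Pos ∧ v α ∈ M.Neg}

/-- `v` belongs to `W^P`: it lies in `W` and has minimal length in its coset `v W_P`. -/
def IsMinRep (v : V ≃ₗ[ℝ] V) : Prop :=
  v ∈ M.W ∧ ∀ u, u ∈ M.W → v⁻¹ * u ∈ M.WP → M.length v ≤ M.length u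

/-- `μ` is the minimal length representative `[w]^P` of the coset `w W_P`. -/
def IsMinRepOf (μ w : V ≃ₗ[ℝ] V) : Prop :=
  (μ ∈ M.W ∧ w⁻¹ * μ ∈ M.WP) ∧
    ∀ u, u ∈ M.W → w⁻¹ * u ∈ M.WP → M.length μ ≤ M.length u

/-- The subset `Φ_S = {α ∈ Φ : σ_S(α) = -α}` determined by an orthogonal set of roots `S`. -/
def PhiSet (S : Finset V) : Set V := {α | α ∈ M.Φ ∧ sigmaOf S α = -α}

/-- A root is long if its squared length is maximal among the roots. -/
def IsLong (α : V) : Prop := ∀ β ∈ M.Φ, ⟪β, β⟫ ≤ ⟪α, α⟫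

/-- Admissible pair: `v ∈ W^P`, `S ⊆ Ψ` a set of pairwise orthogonal roots with
`v(S) ⊆ Φ⁻`. -/
def Admissible (v : V ≃ₗ[ℝ] V) (S : Finset V) : Prop :=
  M.IsMinRep v ∧ (↑S : Set V) ⊆ M.Psi ∧ OrthSet S ∧ ∀ β ∈ S, v β ∈ M.Neg

/-- The length `L(v,S) = (ℓ(σ_{v(S)}) + |S|)/2` of an admissible pair `(v,S)`. -/
def pairL (v : V ≃ₗ[ℝ] V) (S : Finset V) : ℚ :=
  ((M.length (sigmaOf (S.image fun x => v x)) : ℚ) + (S.card : ℚ)) / 2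

end MRSD

section OrthogonalReflections

variable {V : Type} [NormedAddCommGroup V] [InnerProductSpace ℝ V]

lemma inner_sref_sref (α x y : V) : ⟪sref V α x, sref V α y⟫ = ⟪x, y⟫ := by
  by_cases h : (⟪α, α⟫ : ℝ) = 0
  · have h0 : α = 0 := inner_self_eq_zero.mp h
    simp [sref_apply, h0]
  · simp only [sref_apply, inner_sub_left, inner_sub_right, real_inner_smul_left,
      real_inner_smul_right]
    rw [real_inner_comm y α]
    field_simp
    ring

lemma prod_map_sref_apply (l : List V) (hl : l.Pairwise fun a b => (⟪a, b⟫ : ℝ) = 0) (x : V) :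
    (l.map (sref V)).prod x = x - (l.map fun a => (2 * ⟪x, a⟫ / ⟪a, a⟫) • a).sum := by
  induction l with
  | nil => simp
  | cons a l ih =>
    rw [List.pairwise_cons] at hl
    have horth : ∀ m : List V, (∀ b ∈ m, (⟪a, b⟫ : ℝ) = 0) →
        (⟪(m.map fun b => (2 * ⟪x, b⟫ / ⟪b, b⟫) • b).sum, a⟫ : ℝ) = 0 := by
      intro m
      induction m with
      | nil => simp
      | cons b m ihm =>
        intro hm
        rw [List.forall_mem_cons] at hm
        rw [List.map_cons, List.sum_cons, inner_add_left, ihm hm.2, real_inner_smul_left,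
          real_inner_comm a b, hm.1]
        simp
    rw [List.map_cons, List.prod_cons, LinearEquiv.mul_apply, ih hl.2, sref_apply,
      inner_sub_left, horth l hl.1, List.map_cons, List.sum_cons, sub_zero]
    abel

lemma sigmaOf_apply {S : Finset V} (hS : OrthSet S) (x : V) :
    sigmaOf S x = x - ∑ a ∈ S, (2 * ⟪x, a⟫ / ⟪a, a⟫) • a := by
  have hl : S.toList.Pairwise fun a b => (⟪a, b⟫ : ℝ) = 0 := by
    refine List.Pairwise.imp_of_mem ?_ S.nodup_toList
    intro a b ha hb hab
    exact hS (by simpa using ha) (by simpa using hb) hab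
  rw [sigmaOf, prod_map_sref_apply _ hl, Finset.sum_map_toList]

lemma sigmaOf_apply_of_mem {S : Finset V} (hS : OrthSet S) {a : V} (ha : a ∈ S) :
    sigmaOf S a = -a := by
  by_cases h0 : a = 0
  · simp [h0]
  have h : (⟪a, a⟫ : ℝ) ≠ 0 := inner_self_ne_zero.mpr h0
  rw [sigmaOf_apply hS, Finset.sum_eq_single_of_mem a ha]
  · rw [mul_div_assoc, div_self h, mul_one, two_smul]
    abel
  · intro b hb hba
    rw [hS ha hb hba.symm]
    simp

lemma eq_sum_of_sigmaOf_eq_neg {S : Finset V} (hS : OrthSet S) {x : V}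
    (hx : sigmaOf S x = -x) : x = ∑ a ∈ S, (⟪x, a⟫ / ⟪a, a⟫ : ℝ) • a := by
  rw [sigmaOf_apply hS] at hx
  have h2 : (2 : ℝ) • x = (2 : ℝ) • ∑ a ∈ S, (⟪x, a⟫ / ⟪a, a⟫ : ℝ) • a := by
    rw [Finset.smul_sum]
    simp only [smul_smul, ← mul_div_assoc]
    rw [sub_eq_iff_eq_add] at hx
    rw [two_smul]
    nth_rw 1 [hx]
    abel
  exact smul_right_injective V (two_ne_zero (α := ℝ)) h2

lemma OrthSet.image {S : Finset V} (hS : OrthSet S) {u : V ≃ₗ[ℝ] V}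
    (hu : ∀ x y, (⟪u x, u y⟫ : ℝ) = ⟪x, y⟫) : OrthSet (S.image fun x => u x) := by
  intro a ha b hb hab
  simp only [Finset.coe_image, Set.mem_image, Finset.mem_coe] at ha hb
  obtain ⟨x, hx, rfl⟩ := ha
  obtain ⟨y, hy, rfl⟩ := hb
  rw [hu]
  exact hS hx hy fun h => hab (by rw [h])

end OrthogonalReflections

namespace RSD

variable {V : Type} [NormedAddCommGroup V] [InnerProductSpace ℝ V] (D : RSD V)

lemma exists_linearMap_eq_on_simple (c : V → ℝ) : ∃ f : V →ₗ[ℝ] ℝ, ∀ γ ∈ D.Δ, f γ = c γ := by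
  let b := Module.Basis.extend (K := ℝ) (V := V) (s := (D.Δ : Set V)) D.Δ_indep
  refine ⟨b.constr ℝ fun x => c x, fun γ hγ => ?_⟩
  have hmem : γ ∈ LinearIndepOn.extend (K := ℝ) (v := id) D.Δ_indep (Set.subset_univ (D.Δ : Set V)) :=
    LinearIndepOn.subset_extend _ _ hγ
  have hb : b ⟨γ, hmem⟩ = γ := Module.Basis.extend_apply_self _ _
  have := b.constr_basis ℝ (fun x => c x) ⟨γ, hmem⟩
  rwa [hb] at this

lemma not_neg_mem_Neg {α : V} (hα : α ∈ D.Neg) : -α ∉ D.Neg := by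
  intro h
  obtain ⟨hΦ, c, hc⟩ := hα
  obtain ⟨-, d, hd⟩ := h
  obtain ⟨f, hf⟩ := D.exists_linearMap_eq_on_simple fun _ => 1
  have key : ∀ e : V → ℕ, f (∑ γ ∈ D.Δ, (e γ : ℝ) • γ) = ∑ γ ∈ D.Δ, (e γ : ℝ) := by
    intro e
    rw [map_sum]
    exact Finset.sum_congr rfl fun γ hγ => by simp [hf γ hγ]
  have h1 : f (-α) = ∑ γ ∈ D.Δ, (c γ : ℝ) := by rw [← key, ← hc]
  have h2 : f (- -α) = ∑ γ ∈ D.Δ, (d γ : ℝ) := by rw [← key, ← hd]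
  have hd0 : 0 ≤ ∑ γ ∈ D.Δ, (d γ : ℝ) := Finset.sum_nonneg fun _ _ => by positivity
  have hc0 : 0 ≤ ∑ γ ∈ D.Δ, (c γ : ℝ) := Finset.sum_nonneg fun _ _ => by positivity
  rw [map_neg] at h2
  have hsum : ∑ γ ∈ D.Δ, (c γ : ℝ) = 0 := by linarith
  rw [Finset.sum_eq_zero_iff_of_nonneg fun _ _ => by positivity] at hsum
  apply D.nonzero
  have : -α = 0 := by
    rw [hc]
    exact Finset.sum_eq_zero fun γ hγ => by rw [hsum γ hγ, zero_smul]
  rwa [this] at hΦ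

lemma inner_map_map_of_mem_W {u : V ≃ₗ[ℝ] V} (hu : u ∈ D.W) :
    ∀ x y, (⟪u x, u y⟫ : ℝ) = ⟪x, y⟫ := by
  induction hu using Subgroup.closure_induction with
  | mem w hw =>
    obtain ⟨γ, -, rfl⟩ := hw
    exact inner_sref_sref γ
  | one => simp
  | mul v w _ _ hv hw => simp [LinearEquiv.mul_apply, hv, hw]
  | inv w _ hw =>
    intro x y
    rw [← hw, ← LinearEquiv.mul_apply, ← LinearEquiv.mul_apply]
    simp

lemma map_mem_of_mem_W {u : V ≃ₗ[ℝ] V} (hu : u ∈ D.W) : ∀ x ∈ D.Φ, u x ∈ D.Φ := by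
  have hgen : ∀ γ ∈ D.Δ, ∀ x ∈ D.Φ, sref V γ x ∈ D.Φ := fun γ hγ =>
    D.reflClosed γ (D.Δ_sub hγ)
  induction hu using Subgroup.closure_induction with
  | mem w hw =>
    obtain ⟨γ, hγ, rfl⟩ := hw
    exact hgen γ hγ
  | one => simp
  | mul v w _ _ hv hw => exact fun x hx => hv _ (hw x hx)
  | inv w _ hw =>
    intro x hx
    have himage : D.Φ.image w = D.Φ := by
      apply Finset.eq_of_subset_of_card_le (Finset.image_subset_iff.mpr hw)
      rw [Finset.card_image_of_injective _ w.injective]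
    rw [← himage, Finset.mem_image] at hx
    obtain ⟨y, hy, rfl⟩ := hx
    rwa [← LinearEquiv.mul_apply, inv_mul_cancel, LinearEquiv.coe_one, id]

lemma sigmaOf_mem {S : Finset V} (hS : S ⊆ D.Φ) {x : V} (hx : x ∈ D.Φ) : sigmaOf S x ∈ D.Φ := by
  have key : ∀ l : List V, (∀ a ∈ l, a ∈ D.Φ) → (l.map (sref V)).prod x ∈ D.Φ := by
    intro l
    induction l with
    | nil => simpa using hx
    | cons a l ih =>
      intro hl
      rw [List.forall_mem_cons] at hl
      exact D.reflClosed a hl.1 _ (ih hl.2)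
  exact key _ fun a ha => hS (by simpa using ha)

/-- If a functional is bounded by `1` on the roots and equal to `1` on an orthogonal set `A` of
roots, then a root in the span of `A` has coordinates of total absolute value at most `1`. -/
lemma sum_abs_coord_le_one {A : Finset V} (hA : A ⊆ D.Φ) (hAo : OrthSet A) {f : V →ₗ[ℝ] ℝ}
    (hf : ∀ x ∈ D.Φ, f x ≤ 1) (hfA : ∀ a ∈ A, f a = 1) {x : V} (hx : x ∈ D.Φ)
    (hxA : sigmaOf A x = -x) : ∑ a ∈ A, |⟪x, a⟫ / ⟪a, a⟫| ≤ 1 := by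
  let T := A.filter fun a => (⟪x, a⟫ / ⟪a, a⟫ : ℝ) < 0
  have hT : T ⊆ A := Finset.filter_subset _ _
  have hTo : OrthSet T := hAo.mono (Finset.coe_subset.mpr hT)
  have hle := hf _ (D.sigmaOf_mem (hT.trans hA) hx)
  rw [sigmaOf_apply hTo, map_sub, map_sum] at hle
  have hfx : f x = ∑ a ∈ A, (⟪x, a⟫ / ⟪a, a⟫ : ℝ) := by
    conv_lhs => rw [eq_sum_of_sigmaOf_eq_neg hAo hxA]
    rw [map_sum]
    exact Finset.sum_congr rfl fun a ha => by simp [hfA a ha]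
  rw [hfx, Finset.sum_filter, ← Finset.sum_sub_distrib] at hle
  refine le_trans (le_of_eq (Finset.sum_congr rfl fun a ha => ?_)) hle
  rw [map_smul, hfA a ha, smul_eq_mul, mul_one, mul_div_assoc]
  split_ifs with h
  · rw [abs_of_neg h]; ring
  · rw [abs_of_nonneg (not_lt.mp h)]; ring

lemma abs_coord_le_half_or_eq {A : Finset V} (hA : A ⊆ D.Φ) (hAo : OrthSet A) {f : V →ₗ[ℝ] ℝ}
    (hf : ∀ x ∈ D.Φ, f x ≤ 1) (hfA : ∀ a ∈ A, f a = 1) {x : V} (hx : x ∈ D.Φ)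
    (hxA : sigmaOf A x = -x) {a : V} (ha : a ∈ A) :
    |⟪x, a⟫ / ⟪a, a⟫| ≤ 1 / 2 ∨ x = a ∨ x = -a := by
  have hsum := D.sum_abs_coord_le_one hA hAo hf hfA hx hxA
  rw [← Finset.add_sum_erase _ _ ha] at hsum
  by_cases hhalf : |⟪x, a⟫ / ⟪a, a⟫| ≤ 1 / 2
  · exact Or.inl hhalf
  right
  obtain ⟨n, hn⟩ := D.crystal a (hA ha) x hx
  rw [mul_div_assoc] at hn
  have hrest := Finset.sum_nonneg
    (fun b (_ : b ∈ A.erase a) => abs_nonneg (⟪x, b⟫ / ⟪b, b⟫ : ℝ))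
  have hn2 : (2 : ℝ) ≤ |(n : ℝ)| := by
    have : (1 : ℝ) < |(n : ℝ)| := by
      rw [hn, abs_mul, abs_two]
      linarith
    have h : (1 : ℤ) < |n| := by exact_mod_cast this
    exact_mod_cast h
  rw [hn, abs_mul, abs_two] at hn2
  have hone : |⟪x, a⟫ / ⟪a, a⟫| = 1 := by linarith
  have hzero : ∑ b ∈ A.erase a, |⟪x, b⟫ / ⟪b, b⟫| = 0 := by linarith
  rw [Finset.sum_eq_zero_iff_of_nonneg fun _ _ => abs_nonneg _] at hzero
  have hxa : x = (⟪x, a⟫ / ⟪a, a⟫ : ℝ) • a := by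
    conv_lhs => rw [eq_sum_of_sigmaOf_eq_neg hAo hxA, ← Finset.add_sum_erase _ _ ha]
    rw [add_eq_left]
    exact Finset.sum_eq_zero fun b hb => by rw [abs_eq_zero.mp (hzero b hb), zero_smul]
  rcases eq_or_eq_neg_of_abs_eq hone with h | h <;> rw [h] at hxa
  · left; simpa using hxa
  · right; simpa using hxa

lemma subset_of_sigmaOf_eq {A B : Finset V} (hA : A ⊆ D.Φ) (hB : B ⊆ D.Φ) (hAo : OrthSet A)
    (hBo : OrthSet B) (hAn : ∀ a ∈ A, a ∈ D.Neg) (hBn : ∀ b ∈ B, b ∈ D.Neg) {f g : V →ₗ[ℝ] ℝ}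
    (hf : ∀ x ∈ D.Φ, f x ≤ 1) (hfA : ∀ a ∈ A, f a = 1)
    (hg : ∀ x ∈ D.Φ, g x ≤ 1) (hgB : ∀ b ∈ B, g b = 1)
    (hσ : sigmaOf A = sigmaOf B) : A ⊆ B := by
  intro a ha
  by_contra haB
  have haσ : sigmaOf B a = -a := by rw [← hσ, sigmaOf_apply_of_mem hAo ha]
  have ha0 : (⟪a, a⟫ : ℝ) ≠ 0 := inner_self_ne_zero.mpr fun h => D.nonzero (h ▸ hA ha)
  have hhalf : ∀ b ∈ B, |⟪b, a⟫ / ⟪a, a⟫| ≤ 1 / 2 := by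
    intro b hb
    have hbσ : sigmaOf A b = -b := by rw [hσ, sigmaOf_apply_of_mem hBo hb]
    rcases D.abs_coord_le_half_or_eq hA hAo hf hfA (hB hb) hbσ ha with h | h | h
    · exact h
    · exact absurd (h ▸ hb) haB
    · exact absurd (h ▸ hBn b hb) (D.not_neg_mem_Neg (hAn a ha))
  have hle := D.sum_abs_coord_le_one hB hBo hg hgB (hA ha) haσ
  have hone : (1 : ℝ) = ∑ b ∈ B, ⟪a, b⟫ / ⟪b, b⟫ * (⟪b, a⟫ / ⟪a, a⟫) := by
    have h : (⟪a, a⟫ : ℝ) = ∑ b ∈ B, ⟪a, b⟫ / ⟪b, b⟫ * ⟪b, a⟫ := by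
      have h := congrArg (fun y : V => (⟪y, a⟫ : ℝ)) (eq_sum_of_sigmaOf_eq_neg hBo haσ)
      simpa only [sum_inner, real_inner_smul_left] using h
    simp only [← mul_div_assoc]
    rw [← Finset.sum_div, ← h, div_self ha0]
  have hbound : ∑ b ∈ B, (⟪a, b⟫ / ⟪b, b⟫ * (⟪b, a⟫ / ⟪a, a⟫) : ℝ) ≤
      ∑ b ∈ B, |⟪a, b⟫ / ⟪b, b⟫| * (1 / 2) := by
    refine Finset.sum_le_sum fun b hb => (le_abs_self _).trans ?_
    rw [abs_mul]
    exact mul_le_mul_of_nonneg_left (hhalf b hb) (abs_nonneg _)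
  rw [← Finset.sum_mul] at hbound
  linarith

end RSD

namespace MRSD

variable {V : Type} [NormedAddCommGroup V] [InnerProductSpace ℝ V] (M : MRSD V)

lemma exists_marked_coeff : ∃ f : V →ₗ[ℝ] ℝ, (∀ x ∈ M.Φ, f x ≤ 1) ∧ ∀ x ∈ M.Psi, f x = 1 := by
  obtain ⟨f, hf⟩ := M.exists_linearMap_eq_on_simple fun γ => if γ = M.αP then 1 else 0
  have key : ∀ e : V → ℕ, f (∑ γ ∈ M.Δ, (e γ : ℝ) • γ) = e M.αP := by
    intro e
    rw [map_sum, Finset.sum_eq_single_of_mem _ M.αP_mem]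
    · simp [hf _ M.αP_mem]
    · intro γ hγ hne
      simp [hf γ hγ, hne]
  refine ⟨f, fun x hx => ?_, ?_⟩
  · obtain ⟨c, hc⟩ := M.θ_high x hx
    obtain ⟨d, hd, hd1⟩ := M.θ_coeff
    have h1 : f (M.θ - x) = c M.αP := by rw [hc, key]
    have h2 : f M.θ = 1 := by
      rw [hd, key, hd1, Nat.cast_one]
    rw [map_sub, h2] at h1
    have : (0 : ℝ) ≤ c M.αP := by positivity
    linarith
  · rintro x ⟨-, c, rfl, hc⟩
    rw [key, hc, Nat.cast_one]

lemma Admissible.exists_functional {M : MRSD V} {u : V ≃ₗ[ℝ] V} {R : Finset V}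
    (h : M.Admissible u R) : ∃ f : V →ₗ[ℝ] ℝ, (∀ x ∈ M.Φ, f x ≤ 1) ∧
      ∀ a ∈ R.image (fun x => u x), f a = 1 := by
  obtain ⟨f, hf, hf1⟩ := M.exists_marked_coeff
  refine ⟨f ∘ₗ (u⁻¹ : V ≃ₗ[ℝ] V).toLinearMap, fun x hx => ?_, fun a ha => ?_⟩
  · exact hf _ (M.map_mem_of_mem_W (M.W.inv_mem h.1.1) x hx)
  · obtain ⟨x, hx, rfl⟩ := Finset.mem_image.mp ha
    change f ((u⁻¹ * u) x) = 1
    rw [inv_mul_cancel]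
    exact hf1 x (h.2.1 hx)

lemma Admissible.image_subset {M : MRSD V} {u : V ≃ₗ[ℝ] V} {R : Finset V}
    (h : M.Admissible u R) : R.image (fun x => u x) ⊆ M.Φ :=
  Finset.image_subset_iff.mpr fun x hx => M.map_mem_of_mem_W h.1.1 x (h.2.1 hx).1

lemma Admissible.orthSet_image {M : MRSD V} {u : V ≃ₗ[ℝ] V} {R : Finset V}
    (h : M.Admissible u R) : OrthSet (R.image fun x => u x) :=
  h.2.2.1.image (M.inner_map_map_of_mem_W h.1.1)

lemma Admissible.image_neg {M : MRSD V} {u : V ≃ₗ[ℝ] V} {R : Finset V}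
    (h : M.Admissible u R) : ∀ a ∈ R.image (fun x => u x), a ∈ M.Neg :=
  Finset.forall_mem_image.mpr h.2.2.2

lemma Admissible.image_subset_image {M : MRSD V} {u v : V ≃ₗ[ℝ] V} {R S : Finset V}
    (hu : M.Admissible u R) (hv : M.Admissible v S)
    (hσ : sigmaOf (R.image fun x => u x) = sigmaOf (S.image fun x => v x)) :
    R.image (fun x => u x) ⊆ S.image (fun x => v x) := by
  obtain ⟨f, hf, hfA⟩ := hu.exists_functional
  obtain ⟨g, hg, hgB⟩ := hv.exists_functional
  exact M.subset_of_sigmaOf_eq hu.image_subset hv.image_subset hu.orthSet_image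
    hv.orthSet_image hu.image_neg hv.image_neg hf hfA hg hgB hσ

end MRSD

/-- Let `(u,R)` and `(v,S)` be admissible pairs with
`σ_{u(R)} = σ_{v(S)}`.  Then `u(R) = v(S)`. -/
theorem statement17 {V : Type} [NormedAddCommGroup V] [InnerProductSpace ℝ V]
    [FiniteDimensional ℝ V]
    (M : MRSD V) (u v : V ≃ₗ[ℝ] V) (R S : Finset V)
    (hu : M.Admissible u R) (hv : M.Admissible v S)
    (hσ : sigmaOf (R.image fun x => u x) = sigmaOf (S.image fun x => v x)) :
    R.image (fun x => u x) = S.image (fun x => v x) := by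
  exact (hu.image_subset_image hv hσ).antisymm (hv.image_subset_image hu hσ.symm)
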